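/- Let G₁ = S₁ be a k₁-spanner, and for each n ≥ 1 let G_{n+1} be obtained from the disjoint union of G_n and a k_{n+1}-spanner S_{n+1} by adding a single edge joining a central vertex of one of the spanners S₁, ..., S_n to a central vertex of S_{n+1}. Then for every m ≥ 1, every pair (H, H') ∈ Λ_μ(G_m), and every n ≤ m, the restriction (H ∩ E(S_n), H' ∩ E(S_n)) belongs to Λ_μ(S_n). -/

import Mathlib

open Finset

section Defs
variable {V : Type*}

/-- A matching: a set of edges, pairwise non-adjacent. -/
def IsMatchingSet (G : SimpleGraph V) (M : Finset (Sym2 V)) : Prop :=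
  ↑M ⊆ G.edgeSet ∧ ∀ e ∈ M, ∀ f ∈ M, e ≠ f → ∀ v : V, v ∈ e → v ∉ f

/-- A vertex is saturated by a matching if some edge of it is incident to the vertex. -/
def Saturates (M : Finset (Sym2 V)) (v : V) : Prop :=
  ∃ e ∈ M, v ∈ e

/-- ν(G): maximum size of a matching. -/
noncomputable def nuG (G : SimpleGraph V) : ℕ :=
  sSup {n | ∃ M : Finset (Sym2 V), IsMatchingSet G M ∧ M.card = n}

/-- λ(G): maximum of |H| + |H'| over pairs of disjoint matchings. -/
noncomputable def lamG (G : SimpleGraph V) : ℕ :=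
  sSup {n | ∃ H H' : Finset (Sym2 V), IsMatchingSet G H ∧ IsMatchingSet G H' ∧
    Disjoint H H' ∧ H.card + H'.card = n}

/-- Λ(G): set of pairs of disjoint matchings realizing λ(G). -/
def LambdaSet (G : SimpleGraph V) : Set (Finset (Sym2 V) × Finset (Sym2 V)) :=
  {p | IsMatchingSet G p.1 ∧ IsMatchingSet G p.2 ∧ Disjoint p.1 p.2 ∧
    p.1.card + p.2.card = lamG G}

/-- μ(G): maximum of |H| over pairs (H, H') ∈ Λ(G). -/
noncomputable def muG (G : SimpleGraph V) : ℕ :=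
  sSup {n | ∃ p ∈ LambdaSet G, p.1.card = n}

/-- Λ_μ(G): pairs in Λ(G) with |H| = μ(G). -/
def LambdaMuSet (G : SimpleGraph V) : Set (Finset (Sym2 V) × Finset (Sym2 V)) :=
  {p | p ∈ LambdaSet G ∧ p.1.card = muG G}

end Defs

/-- Vertex type of a k-spanner: two central vertices and 4+k legs of two vertices each. -/
abbrev SpannerV (k : ℕ) : Type := Fin 2 ⊕ (Fin (4 + k) × Fin 2)

/-- The k-spanner determined by the attachment function `attach` assigning each of
the 4+k legs to one of the two central vertices.  Leg `i` consists of the middle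
vertex `Sum.inr (i, 0)` and the leaf `Sum.inr (i, 1)`; its inner edge joins the
central vertex `Sum.inl (attach i)` to `Sum.inr (i, 0)` and its outer edge joins
`Sum.inr (i, 0)` to `Sum.inr (i, 1)`. The two central vertices are adjacent. -/
def spannerGraph (k : ℕ) (attach : Fin (4 + k) → Fin 2) : SimpleGraph (SpannerV k) :=
  SimpleGraph.fromRel (fun u v =>
    (u = Sum.inl 0 ∧ v = Sum.inl 1) ∨
    (∃ i : Fin (4 + k), u = Sum.inl (attach i) ∧ v = Sum.inr (i, 0)) ∨
    (∃ i : Fin (4 + k), u = Sum.inr (i, 0) ∧ v = Sum.inr (i, 1)))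

/-- `attach` describes a genuine k-spanner: at least two legs attached to each
central vertex (the base spanner already has two legs at each). -/
def IsKSpannerAttach (k : ℕ) (attach : Fin (4 + k) → Fin 2) : Prop :=
  2 ≤ (Finset.univ.filter fun i => attach i = 0).card ∧
  2 ≤ (Finset.univ.filter fun i => attach i = 1).card

/-- The chain of spanners G_m: the disjoint union of spanners S_1, ..., S_m
(S_i being a (k i)-spanner given by attach i), where for every i ≥ 1 a single new
edge joins the central vertex `c' i` of S_i to the central vertex `c i` of an
earlier spanner S_(j i) (j i < i). -/
def chainGraph (m : ℕ) (k : Fin m → ℕ) (attach : ∀ i : Fin m, Fin (4 + k i) → Fin 2)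
    (j : Fin m → Fin m) (c c' : Fin m → Fin 2) :
    SimpleGraph ((i : Fin m) × SpannerV (k i)) :=
  SimpleGraph.fromRel (fun u v =>
    (∃ (i : Fin m) (x y : SpannerV (k i)), u = ⟨i, x⟩ ∧ v = ⟨i, y⟩ ∧
      (spannerGraph (k i) (attach i)).Adj x y) ∨
    (∃ i : Fin m, 0 < (i : ℕ) ∧ u = ⟨j i, Sum.inl (c i)⟩ ∧ v = ⟨i, Sum.inl (c' i)⟩))

section DisjointMatchings
variable {V : Type*} {G : SimpleGraph V}

theorem IsMatchingSet.eq_of_mem {M : Finset (Sym2 V)} (hM : IsMatchingSet G M) {e f : Sym2 V}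
    (he : e ∈ M) (hf : f ∈ M) {v : V} (hve : v ∈ e) (hvf : v ∈ f) : e = f := by
  by_contra h
  exact hM.2 e he f hf h v hve hvf

theorem isMatchingSet_empty : IsMatchingSet G ∅ := by
  simp [IsMatchingSet]

theorem card_add_card_le_lamG [Finite V] {H H' : Finset (Sym2 V)} (h : IsMatchingSet G H)
    (h' : IsMatchingSet G H') (hd : Disjoint H H') : H.card + H'.card ≤ lamG G := by
  classical
  have := Fintype.ofFinite V
  refine le_csSup ⟨2 * (univ : Finset (Sym2 V)).card, ?_⟩ ⟨H, H', h, h', hd, rfl⟩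
  rintro n ⟨A, B, -, -, -, rfl⟩
  have hA := card_le_univ A
  have hB := card_le_univ B
  rw [card_univ]
  lia

theorem card_fst_le_muG [Finite V] {p : Finset (Sym2 V) × Finset (Sym2 V)}
    (hp : p ∈ LambdaSet G) : p.1.card ≤ muG G := by
  classical
  have := Fintype.ofFinite V
  refine le_csSup ⟨(univ : Finset (Sym2 V)).card, ?_⟩ ⟨p, hp, rfl⟩
  rintro n ⟨q, -, rfl⟩
  exact card_le_univ q.1

theorem lambdaMuSet_nonempty [Finite V] (G : SimpleGraph V) : (LambdaMuSet G).Nonempty := by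
  have hlam : (LambdaSet G).Nonempty := by
    have hmem := Nat.sSup_mem (s := {n | ∃ H H' : Finset (Sym2 V), IsMatchingSet G H ∧
      IsMatchingSet G H' ∧ Disjoint H H' ∧ H.card + H'.card = n})
      ⟨0, ∅, ∅, isMatchingSet_empty, isMatchingSet_empty, by simp, by simp⟩
      ⟨lamG G, by
        rintro n ⟨A, B, hA, hB, hd, rfl⟩
        exact card_add_card_le_lamG hA hB hd⟩
    obtain ⟨A, B, hA, hB, hd, h⟩ := hmem
    exact ⟨(A, B), hA, hB, hd, h⟩
  obtain ⟨p, hp⟩ := hlam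
  obtain ⟨q, hq, h⟩ := Nat.sSup_mem (s := {n | ∃ p ∈ LambdaSet G, p.1.card = n}) ⟨_, p, hp, rfl⟩
    ⟨muG G, by
      rintro n ⟨q, hq, rfl⟩
      exact card_fst_le_muG hq⟩
  exact ⟨q, hq, h⟩

open scoped Classical in
/-- The members of `M` that meet `C` are counted by disjoint parts of `C`. -/
theorem IsMatchingSet.sum_card_filter_le {M : Finset (Sym2 V)} (hM : IsMatchingSet G M)
    (C : Finset V) : ∑ e ∈ M, (C.filter (· ∈ e)).card ≤ C.card := by
  rw [← card_biUnion]
  · exact card_le_card (biUnion_subset.2 fun e _ => filter_subset _ _)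
  · intro e he f hf hef
    rw [Function.onFun, disjoint_left]
    intro v hv hv'
    exact hM.2 e he f hf hef v (mem_filter.1 hv).2 (mem_filter.1 hv').2

open scoped Classical in
theorem IsMatchingSet.card_sdiff_le {M O : Finset (Sym2 V)} (hM : IsMatchingSet G M)
    {C : Finset V} (hOC : ∀ e ∈ G.edgeSet, e ∉ O → ∃ v ∈ C, v ∈ e) : (M \ O).card ≤ C.card := by
  refine le_trans ?_ (hM.sum_card_filter_le C)
  rw [card_eq_sum_ones]
  refine (sum_le_sum fun e he => ?_).trans (sum_le_sum_of_subset (sdiff_subset (t := O)))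
  obtain ⟨heM, heO⟩ := mem_sdiff.1 he
  obtain ⟨v, hv, hve⟩ := hOC e (hM.1 heM) heO
  exact card_pos.2 ⟨v, mem_filter.2 ⟨hv, hve⟩⟩

open scoped Classical in
theorem IsMatchingSet.card_sdiff_lt {M O : Finset (Sym2 V)} (hM : IsMatchingSet G M)
    {C : Finset V} (hOC : ∀ e ∈ G.edgeSet, e ∉ O → ∃ v ∈ C, v ∈ e) {u v : V} (huv : u ≠ v)
    (hu : u ∈ C) (hv : v ∈ C) (he : s(u, v) ∈ M) (heO : s(u, v) ∉ O) :
    (M \ O).card < C.card := by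
  refine lt_of_lt_of_le ?_ (hM.sum_card_filter_le C)
  rw [card_eq_sum_ones]
  refine (sum_lt_sum (fun e he => ?_) ⟨s(u, v), mem_sdiff.2 ⟨he, heO⟩, ?_⟩).trans_le
    (sum_le_sum_of_subset (sdiff_subset (t := O)))
  · obtain ⟨heM, heO⟩ := mem_sdiff.1 he
    obtain ⟨v, hv, hve⟩ := hOC e (hM.1 heM) heO
    exact card_pos.2 ⟨v, mem_filter.2 ⟨hv, hve⟩⟩
  · exact one_lt_card.2 ⟨u, by simp [hu], v, by simp [hv], huv⟩

/-- If the edges outside `O` all meet `C`, then disjoint matchings have at most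
`|O| + 2|C|` edges together, and fewer if one of them has an edge outside `O` with both
ends in `C`. -/
theorem card_add_card_lt_of_mem {H H' O : Finset (Sym2 V)} (hH : IsMatchingSet G H)
    (hH' : IsMatchingSet G H') (hd : Disjoint H H') {C : Finset V}
    (hOC : ∀ e ∈ G.edgeSet, e ∉ O → ∃ v ∈ C, v ∈ e) {u v : V} (huv : u ≠ v)
    (hu : u ∈ C) (hv : v ∈ C) (he : s(u, v) ∈ H ∨ s(u, v) ∈ H') (heO : s(u, v) ∉ O) :
    H.card + H'.card < O.card + 2 * C.card := by
  classical
  have hO : (H ∩ O).card + (H' ∩ O).card ≤ O.card := by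
    rw [← card_union_of_disjoint (hd.mono inter_subset_left inter_subset_left)]
    exact card_le_card (union_subset inter_subset_right inter_subset_right)
  have h1 := card_sdiff_add_card_inter H O
  have h2 := card_sdiff_add_card_inter H' O
  have h3 := hH.card_sdiff_le hOC
  have h4 := hH'.card_sdiff_le hOC
  rcases he with he | he
  · have := hH.card_sdiff_lt hOC huv hu hv he heO
    lia
  · have := hH'.card_sdiff_lt hOC huv hu hv he heO
    lia

end DisjointMatchings

section Sigma
variable {ι : Type*} {V : ι → Type*}

theorem Sym2.map_sigmaMk_injective :
    Function.Injective fun p : (i : ι) × Sym2 (V i) => Sym2.map (Sigma.mk p.1) p.2 := by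
  rintro ⟨i, e⟩ ⟨i', e'⟩ h
  dsimp only at h
  obtain rfl : i = i' := by
    induction e with | _ x y =>
    have hx : (⟨i, x⟩ : Sigma V) ∈ Sym2.map (Sigma.mk i') e' := by simp [← h]
    obtain ⟨z, -, hz⟩ := Sym2.mem_map.1 hx
    exact (congrArg Sigma.fst hz).symm
  rw [Sym2.map.injective sigma_mk_injective h]

/-- The edges of `M` inside the `i`-th summand. -/
noncomputable def fiberEdges (M : Finset (Sym2 (Sigma V))) (i : ι) : Finset (Sym2 (V i)) :=
  M.preimage (Sym2.map (Sigma.mk i)) (Sym2.map.injective sigma_mk_injective).injOn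

@[simp]
theorem mem_fiberEdges {M : Finset (Sym2 (Sigma V))} {i : ι} {e : Sym2 (V i)} :
    e ∈ fiberEdges M i ↔ Sym2.map (Sigma.mk i) e ∈ M := by
  simp [fiberEdges]

variable {S : ∀ i, SimpleGraph (V i)} {G : SimpleGraph (Sigma V)}

theorem map_mem_edgeSet_iff (hG : ∀ i x y, G.Adj ⟨i, x⟩ ⟨i, y⟩ ↔ (S i).Adj x y) {i : ι}
    {e : Sym2 (V i)} : Sym2.map (Sigma.mk i) e ∈ G.edgeSet ↔ e ∈ (S i).edgeSet := by
  induction e with | _ x y => simp [hG]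

theorem IsMatchingSet.fiberEdges (hG : ∀ i x y, G.Adj ⟨i, x⟩ ⟨i, y⟩ ↔ (S i).Adj x y)
    {M : Finset (Sym2 (Sigma V))} (hM : IsMatchingSet G M) (i : ι) :
    IsMatchingSet (S i) (fiberEdges M i) := by
  refine ⟨fun e he => (map_mem_edgeSet_iff hG).1 (hM.1 (mem_fiberEdges.1 he)), ?_⟩
  intro e he f hf hef v hve hvf
  exact hM.2 _ (mem_fiberEdges.1 he) _ (mem_fiberEdges.1 hf)
    ((Sym2.map.injective sigma_mk_injective).ne hef) ⟨i, v⟩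
    (Sym2.mem_map.2 ⟨v, hve, rfl⟩) (Sym2.mem_map.2 ⟨v, hvf, rfl⟩)

variable [Fintype ι]

/-- The union of edge sets of the summands. -/
def sigmaEdges (M : ∀ i, Finset (Sym2 (V i))) : Finset (Sym2 (Sigma V)) :=
  (univ.sigma M).map ⟨_, Sym2.map_sigmaMk_injective⟩

theorem mem_sigmaEdges {M : ∀ i, Finset (Sym2 (V i))} {e : Sym2 (Sigma V)} :
    e ∈ sigmaEdges M ↔ ∃ i, ∃ f ∈ M i, Sym2.map (Sigma.mk i) f = e := by
  simp [sigmaEdges]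

theorem card_sigmaEdges (M : ∀ i, Finset (Sym2 (V i))) :
    (sigmaEdges M).card = ∑ i, (M i).card := by
  simp [sigmaEdges]

theorem disjoint_sigmaEdges {M N : ∀ i, Finset (Sym2 (V i))} (h : ∀ i, Disjoint (M i) (N i)) :
    Disjoint (sigmaEdges M) (sigmaEdges N) := by
  rw [sigmaEdges, sigmaEdges, disjoint_map, disjoint_left]
  rintro ⟨i, e⟩ he he'
  exact disjoint_left.1 (h i) (mem_sigma.1 he).2 (mem_sigma.1 he').2

theorem sigmaEdges_fiberEdges {M : Finset (Sym2 (Sigma V))}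
    (hM : ∀ e ∈ M, ∃ i f, Sym2.map (Sigma.mk i) f = e) : sigmaEdges (fiberEdges M) = M := by
  ext e
  rw [mem_sigmaEdges]
  constructor
  · rintro ⟨i, f, hf, rfl⟩
    exact mem_fiberEdges.1 hf
  · intro he
    obtain ⟨i, f, rfl⟩ := hM e he
    exact ⟨i, f, mem_fiberEdges.2 he, rfl⟩

theorem isMatchingSet_sigmaEdges (hG : ∀ i x y, G.Adj ⟨i, x⟩ ⟨i, y⟩ ↔ (S i).Adj x y)
    {M : ∀ i, Finset (Sym2 (V i))} (hM : ∀ i, IsMatchingSet (S i) (M i)) :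
    IsMatchingSet G (sigmaEdges M) := by
  constructor
  · intro e he
    obtain ⟨i, f, hf, rfl⟩ := mem_sigmaEdges.1 he
    exact (map_mem_edgeSet_iff hG).2 ((hM i).1 hf)
  · intro e he e' he' hne v hv hv'
    obtain ⟨i, f, hf, rfl⟩ := mem_sigmaEdges.1 he
    obtain ⟨i', f', hf', rfl⟩ := mem_sigmaEdges.1 he'
    obtain ⟨x, hx, rfl⟩ := Sym2.mem_map.1 hv
    obtain ⟨x', hx', h⟩ := Sym2.mem_map.1 hv'
    obtain rfl : i' = i := congrArg Sigma.fst h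
    obtain rfl := sigma_mk_injective h
    exact hne (congrArg _ ((hM i').eq_of_mem hf hf' hx hx'))

variable [∀ i, Finite (V i)]

theorem sum_lamG_le (hG : ∀ i x y, G.Adj ⟨i, x⟩ ⟨i, y⟩ ↔ (S i).Adj x y) :
    ∑ i, lamG (S i) ≤ lamG G := by
  choose p hp using fun i => lambdaMuSet_nonempty (S i)
  have h := card_add_card_le_lamG (isMatchingSet_sigmaEdges hG fun i => (hp i).1.1)
    (isMatchingSet_sigmaEdges hG fun i => (hp i).1.2.1)
    (disjoint_sigmaEdges fun i => (hp i).1.2.2.1)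
  rw [card_sigmaEdges, card_sigmaEdges, ← sum_add_distrib] at h
  exact (sum_congr rfl fun i _ => (hp i).1.2.2.2).symm.trans_le h

/-- If a pair in `Λ_μ` of a graph on a disjoint union uses no edge between different
summands, then its restrictions to the summands are in their `Λ_μ`. -/
theorem fiberEdges_mem_lambdaMuSet (hG : ∀ i x y, G.Adj ⟨i, x⟩ ⟨i, y⟩ ↔ (S i).Adj x y)
    {H H' : Finset (Sym2 (Sigma V))} (h : (H, H') ∈ LambdaMuSet G)
    (hH : ∀ e ∈ H, ∃ i f, Sym2.map (Sigma.mk i) f = e)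
    (hH' : ∀ e ∈ H', ∃ i f, Sym2.map (Sigma.mk i) f = e) (n : ι) :
    (fiberEdges H n, fiberEdges H' n) ∈ LambdaMuSet (S n) := by
  obtain ⟨⟨hM, hM', hd, hlam⟩, hmu⟩ := h
  have hfd (i : ι) : Disjoint (fiberEdges H i) (fiberEdges H' i) :=
    disjoint_left.2 fun e he he' =>
      disjoint_left.1 hd (mem_fiberEdges.1 he) (mem_fiberEdges.1 he')
  have hcard : H.card = ∑ i, (fiberEdges H i).card := by
    rw [← card_sigmaEdges, sigmaEdges_fiberEdges hH]
  have hcard' : H'.card = ∑ i, (fiberEdges H' i).card := by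
    rw [← card_sigmaEdges, sigmaEdges_fiberEdges hH']
  have hle (i : ι) : (fiberEdges H i).card + (fiberEdges H' i).card ≤ lamG (S i) :=
    card_add_card_le_lamG (hM.fiberEdges hG i) (hM'.fiberEdges hG i) (hfd i)
  have hsum : ∑ i, ((fiberEdges H i).card + (fiberEdges H' i).card) = lamG G := by
    rw [sum_add_distrib, ← hcard, ← hcard', ← hlam]
  have hsum_lam : ∑ i, lamG (S i) = lamG G :=
    (sum_lamG_le hG).antisymm (hsum ▸ sum_le_sum fun i _ => hle i)
  have heq (i : ι) : (fiberEdges H i).card + (fiberEdges H' i).card = lamG (S i) :=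
    (sum_eq_sum_iff_of_le fun i _ => hle i).1 (hsum.trans hsum_lam.symm) i (mem_univ i)
  have hmem (i : ι) : (fiberEdges H i, fiberEdges H' i) ∈ LambdaSet (S i) :=
    ⟨hM.fiberEdges hG i, hM'.fiberEdges hG i, hfd i, heq i⟩
  refine ⟨hmem n, ?_⟩
  choose p hp using fun i => lambdaMuSet_nonempty (S i)
  have hglue : (sigmaEdges fun i => (p i).1, sigmaEdges fun i => (p i).2) ∈ LambdaSet G := by
    refine ⟨isMatchingSet_sigmaEdges hG fun i => (hp i).1.1,
      isMatchingSet_sigmaEdges hG fun i => (hp i).1.2.1,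
      disjoint_sigmaEdges fun i => (hp i).1.2.2.1, ?_⟩
    rw [card_sigmaEdges, card_sigmaEdges, ← sum_add_distrib, ← hsum_lam]
    exact sum_congr rfl fun i _ => (hp i).1.2.2.2
  have hmu_le : ∑ i, muG (S i) ≤ ∑ i, (fiberEdges H i).card := by
    have := card_fst_le_muG hglue
    rw [card_sigmaEdges, ← hmu, hcard] at this
    exact (sum_congr rfl fun i _ => (hp i).2).symm.trans_le this
  have hle_mu (i : ι) : (fiberEdges H i).card ≤ muG (S i) := card_fst_le_muG (hmem i)
  exact (sum_eq_sum_iff_of_le fun i _ => hle_mu i).1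
    ((sum_le_sum fun i _ => hle_mu i).antisymm hmu_le) n (mem_univ n)

end Sigma

section Spanner
variable {k : ℕ} {attach : Fin (4 + k) → Fin 2}

/-- The inner edge of leg `i` if `i ∈ X`, and its outer edge otherwise. -/
def legEdge (attach : Fin (4 + k) → Fin 2) (X : Finset (Fin (4 + k))) (i : Fin (4 + k)) :
    Sym2 (SpannerV k) :=
  if i ∈ X then s(Sum.inl (attach i), Sum.inr (i, 0)) else s(Sum.inr (i, 0), Sum.inr (i, 1))

theorem legEdge_mem_edgeSet (X : Finset (Fin (4 + k))) (i : Fin (4 + k)) :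
    legEdge attach X i ∈ (spannerGraph k attach).edgeSet := by
  unfold legEdge
  split_ifs <;> simp [spannerGraph]

theorem legEdge_eq_legEdge {X Y : Finset (Fin (4 + k))} {i i' : Fin (4 + k)}
    (h : legEdge attach X i = legEdge attach Y i') : i = i' ∧ (i ∈ X ↔ i' ∈ Y) := by
  unfold legEdge at h
  split_ifs at h <;> simp_all

theorem isMatchingSet_image_legEdge {X T : Finset (Fin (4 + k))} (hX : Set.InjOn attach X) :
    IsMatchingSet (spannerGraph k attach) (T.image (legEdge attach X)) := by
  constructor
  · intro e he
    obtain ⟨i, -, rfl⟩ := mem_image.1 he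
    exact legEdge_mem_edgeSet X i
  · intro e he f hf hef v hve hvf
    obtain ⟨i, -, rfl⟩ := mem_image.1 he
    obtain ⟨i', -, rfl⟩ := mem_image.1 hf
    have hne : i ≠ i' := fun h => hef (congrArg _ h)
    have hX' : i ∈ X → i' ∈ X → attach i ≠ attach i' := fun h h' ha => hne (hX h h' ha)
    unfold legEdge at hve hvf
    split_ifs at hve hvf <;> aesop

theorem card_image_legEdge (X T : Finset (Fin (4 + k))) :
    (T.image (legEdge attach X)).card = T.card :=
  card_image_of_injective _ fun _ _ h => (legEdge_eq_legEdge h).1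

/-- The matchings contain two inner edges each, and together all outer edges. -/
theorem IsKSpannerAttach.le_lamG (h : IsKSpannerAttach k attach) :
    (4 + k) + 4 ≤ lamG (spannerGraph k attach) := by
  obtain ⟨p₀, hp₀, q₀, hq₀, h₀⟩ := one_lt_card.1 h.1
  obtain ⟨p₁, hp₁, q₁, hq₁, h₁⟩ := one_lt_card.1 h.2
  simp only [mem_filter, mem_univ, true_and] at hp₀ hq₀ hp₁ hq₁
  have hpp : p₀ ≠ p₁ := by rintro rfl; simp_all
  have hpq : p₀ ≠ q₁ := by rintro rfl; simp_all
  have hqp : q₀ ≠ p₁ := by rintro rfl; simp_all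
  have hqq : q₀ ≠ q₁ := by rintro rfl; simp_all
  have hX : Set.InjOn attach ({p₀, p₁} : Finset (Fin (4 + k))) := by
    rw [coe_pair, Set.injOn_pair]
    simp [hp₀, hp₁]
  have hY : Set.InjOn attach ({q₀, q₁} : Finset (Fin (4 + k))) := by
    rw [coe_pair, Set.injOn_pair]
    simp [hq₀, hq₁]
  have hd : Disjoint (univ.image (legEdge attach {p₀, p₁}))
      (({p₀, p₁, q₀, q₁} : Finset (Fin (4 + k))).image (legEdge attach {q₀, q₁})) := by
    rw [disjoint_left]
    intro e he he'
    obtain ⟨i, -, rfl⟩ := mem_image.1 he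
    obtain ⟨i', hi', h'⟩ := mem_image.1 he'
    obtain ⟨rfl, hiff⟩ := legEdge_eq_legEdge h'
    simp only [mem_insert, mem_singleton] at hi' hiff
    grind
  have hle := card_add_card_le_lamG (isMatchingSet_image_legEdge hX)
    (isMatchingSet_image_legEdge hY) hd
  have hT : ({p₀, p₁, q₀, q₁} : Finset (Fin (4 + k))).card = 4 := by
    rw [card_insert_of_notMem (by simp [*]), card_insert_of_notMem (by simp [hqp.symm, *]),
      card_pair hqq]
  rwa [card_image_legEdge, card_image_legEdge, hT, card_univ, Fintype.card_fin] at hle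

end Spanner

section Chain
variable {m : ℕ} {k : Fin m → ℕ} {attach : ∀ i : Fin m, Fin (4 + k i) → Fin 2}
  {j : Fin m → Fin m} {c c' : Fin m → Fin 2}

theorem chainGraph_adj_iff (hj : ∀ i : Fin m, 0 < (i : ℕ) → j i < i) (i : Fin m)
    (x y : SpannerV (k i)) : (chainGraph m k attach j c c').Adj ⟨i, x⟩ ⟨i, y⟩ ↔
      (spannerGraph (k i) (attach i)).Adj x y := by
  constructor
  · rintro ⟨-, (⟨i', x', y', hx, hy, h⟩ | ⟨i', hi, hx, hy⟩) |
      (⟨i', x', y', hx, hy, h⟩ | ⟨i', hi, hx, hy⟩)⟩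
    · cases hx; cases hy; exact h
    · have hi₁ : i = j i' := congrArg Sigma.fst hx
      have hi₂ : i = i' := congrArg Sigma.fst hy
      exact absurd (hi₁.symm.trans hi₂) (hj i' hi).ne
    · cases hx; cases hy; exact h.symm
    · have hi₁ : i = j i' := congrArg Sigma.fst hx
      have hi₂ : i = i' := congrArg Sigma.fst hy
      exact absurd (hi₁.symm.trans hi₂) (hj i' hi).ne
  · intro h
    exact ⟨fun he => h.ne (eq_of_heq (Sigma.mk.inj he).2), Or.inl (Or.inl ⟨i, x, y, rfl, rfl, h⟩)⟩

theorem edge_chainGraph_cases {e : Sym2 ((i : Fin m) × SpannerV (k i))}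
    (he : e ∈ (chainGraph m k attach j c c').edgeSet) :
    (∃ i, ∃ f ∈ (spannerGraph (k i) (attach i)).edgeSet, Sym2.map (Sigma.mk i) f = e) ∨
      ∃ i : Fin m, 0 < (i : ℕ) ∧ e = s(⟨j i, Sum.inl (c i)⟩, ⟨i, Sum.inl (c' i)⟩) := by
  induction e with | _ u v =>
  obtain ⟨-, (⟨i, x, y, rfl, rfl, h⟩ | ⟨i, hi, rfl, rfl⟩) |
    (⟨i, x, y, rfl, rfl, h⟩ | ⟨i, hi, rfl, rfl⟩)⟩ := he
  · exact Or.inl ⟨i, s(x, y), h, rfl⟩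
  · exact Or.inr ⟨i, hi, rfl⟩
  · exact Or.inl ⟨i, s(y, x), h.symm, rfl⟩
  · exact Or.inr ⟨i, hi, Sym2.eq_swap⟩

theorem edge_spannerGraph_cases {k : ℕ} {attach : Fin (4 + k) → Fin 2} {e : Sym2 (SpannerV k)}
    (he : e ∈ (spannerGraph k attach).edgeSet) :
    (∃ i, legEdge attach ∅ i = e) ∨ ∃ a, Sum.inl a ∈ e := by
  induction e with | _ u v =>
  obtain ⟨-, (⟨rfl, rfl⟩ | ⟨i, rfl, rfl⟩ | ⟨i, rfl, rfl⟩) |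
    (⟨rfl, rfl⟩ | ⟨i, rfl, rfl⟩ | ⟨i, rfl, rfl⟩)⟩ := he
  · exact Or.inr ⟨0, by simp⟩
  · exact Or.inr ⟨attach i, by simp⟩
  · exact Or.inl ⟨i, by simp [legEdge]⟩
  · exact Or.inr ⟨0, by simp⟩
  · exact Or.inr ⟨attach i, by simp⟩
  · exact Or.inl ⟨i, by simp [legEdge]⟩

/-- Optimal pairs of disjoint matchings of a chain of spanners avoid the connecting edges. -/
theorem exists_map_eq_of_mem_lambdaSet (hattach : ∀ i, IsKSpannerAttach (k i) (attach i))
    (hj : ∀ i : Fin m, 0 < (i : ℕ) → j i < i)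
    {H H' : Finset (Sym2 ((i : Fin m) × SpannerV (k i)))}
    (h : (H, H') ∈ LambdaSet (chainGraph m k attach j c c'))
    {e : Sym2 ((i : Fin m) × SpannerV (k i))} (he : e ∈ H ∨ e ∈ H') :
    ∃ i f, Sym2.map (Sigma.mk i) f = e := by
  obtain ⟨hM, hM', hd, hlam⟩ := h
  have heG : e ∈ (chainGraph m k attach j c c').edgeSet :=
    he.elim (fun h => hM.1 h) fun h => hM'.1 h
  obtain ⟨i, f, -, hf⟩ | ⟨i, hi, rfl⟩ := edge_chainGraph_cases heG
  · exact ⟨i, f, hf⟩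
  let O := sigmaEdges fun i => univ.image (legEdge (attach i) ∅)
  let C : Finset ((i : Fin m) × SpannerV (k i)) :=
    univ.sigma fun i => univ.map Function.Embedding.inl
  have hO : O.card = ∑ i, (4 + k i) := by
    simp only [O, card_sigmaEdges, card_image_legEdge, card_univ, Fintype.card_fin]
  have hC : C.card = m * 2 := by
    simp [C]
  have hmemC (i : Fin m) (a : Fin 2) : (⟨i, Sum.inl a⟩ : (i : Fin m) × SpannerV (k i)) ∈ C := by
    simp [C]
  have hOC : ∀ e ∈ (chainGraph m k attach j c c').edgeSet, e ∉ O → ∃ v ∈ C, v ∈ e := by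
    intro e he heO
    obtain ⟨i, f, hf, rfl⟩ | ⟨i, hi, rfl⟩ := edge_chainGraph_cases he
    · obtain ⟨l, rfl⟩ | ⟨a, ha⟩ := edge_spannerGraph_cases hf
      · exact absurd (mem_sigmaEdges.2 ⟨i, _, mem_image_of_mem _ (mem_univ l), rfl⟩) heO
      · exact ⟨_, hmemC i a, Sym2.mem_map.2 ⟨_, ha, rfl⟩⟩
    · exact ⟨_, hmemC i _, Sym2.mem_mk_right _ _⟩
  have hnotO : s((⟨j i, Sum.inl (c i)⟩ : (i : Fin m) × SpannerV (k i)),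
      ⟨i, Sum.inl (c' i)⟩) ∉ O := by
    intro hmem
    obtain ⟨i', f, -, hf⟩ := mem_sigmaEdges.1 hmem
    obtain ⟨x, -, hx⟩ := Sym2.mem_map.1 (hf ▸ Sym2.mem_mk_left _ _)
    obtain ⟨y, -, hy⟩ := Sym2.mem_map.1 (hf ▸ Sym2.mem_mk_right _ _)
    exact (hj i hi).ne ((congrArg Sigma.fst hx).symm.trans (congrArg Sigma.fst hy))
  have hlt := card_add_card_lt_of_mem hM hM' hd hOC
    (fun h => (hj i hi).ne (congrArg Sigma.fst h)) (hmemC _ _) (hmemC _ _) he hnotO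
  have hge : ∑ i, ((4 + k i) + 4) ≤ lamG (chainGraph m k attach j c c') :=
    (sum_le_sum fun i _ => (hattach i).le_lamG).trans (sum_lamG_le (chainGraph_adj_iff hj))
  rw [sum_add_distrib, sum_const, card_univ, Fintype.card_fin, smul_eq_mul] at hge
  dsimp only at hlam
  lia

end Chain

open scoped Classical in
/-- In a chain of spanners G_m, for every (H, H') ∈ Λ_μ(G_m) and every n ≤ m, the
restriction (H ∩ E(S_n), H' ∩ E(S_n)) belongs to Λ_μ(S_n) (expressed via the
injection `Sym2.map (Sigma.mk n)` of the edges of S_n into the chain). -/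
theorem stmt8 (m : ℕ) (hm : 1 ≤ m) (k : Fin m → ℕ)
    (attach : ∀ i : Fin m, Fin (4 + k i) → Fin 2)
    (hattach : ∀ i : Fin m, IsKSpannerAttach (k i) (attach i))
    (j : Fin m → Fin m) (hj : ∀ i : Fin m, 0 < (i : ℕ) → j i < i)
    (c c' : Fin m → Fin 2)
    (H H' : Finset (Sym2 ((i : Fin m) × SpannerV (k i))))
    (hHH : (H, H') ∈ LambdaMuSet (chainGraph m k attach j c c')) :
    ∀ n : Fin m,
      ∃ q ∈ LambdaMuSet (spannerGraph (k n) (attach n)),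
        q.1.image (Sym2.map (Sigma.mk n)) =
          H ∩ ((spannerGraph (k n) (attach n)).edgeFinset.image (Sym2.map (Sigma.mk n))) ∧
        q.2.image (Sym2.map (Sigma.mk n)) =
          H' ∩ ((spannerGraph (k n) (attach n)).edgeFinset.image (Sym2.map (Sigma.mk n))) := by
  intro n
  have hG := chainGraph_adj_iff (attach := attach) (c := c) (c' := c') hj
  have himage {M : Finset (Sym2 ((i : Fin m) × SpannerV (k i)))}
      (hM : IsMatchingSet (chainGraph m k attach j c c') M) :
      (fiberEdges M n).image (Sym2.map (Sigma.mk n)) =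
        M ∩ ((spannerGraph (k n) (attach n)).edgeFinset.image (Sym2.map (Sigma.mk n))) := by
    ext e
    simp only [mem_image, mem_inter, mem_fiberEdges, SimpleGraph.mem_edgeFinset]
    constructor
    · rintro ⟨f, hf, rfl⟩
      exact ⟨hf, f, (map_mem_edgeSet_iff hG).1 (hM.1 hf), rfl⟩
    · rintro ⟨he, f, -, rfl⟩
      exact ⟨f, he, rfl⟩
  exact ⟨(fiberEdges H n, fiberEdges H' n),
    fiberEdges_mem_lambdaMuSet hG hHH
      (fun e he => exists_map_eq_of_mem_lambdaSet hattach hj hHH.1 (Or.inl he))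
      (fun e he => exists_map_eq_of_mem_lambdaSet hattach hj hHH.1 (Or.inr he)) n,
    himage hHH.1.1, himage hHH.1.2.1⟩
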